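/- Integrality of optimal delivery quantities under integer data: suppose ŷ(i,t) ∈ ℕ for all i ∈ N and t ∈ T, I0(i) ∈ ℤ for all i ∈ N, and Q, Imax, M ∈ ℤ with Q ≥ 0 and M ≥ 0. If the single-scenario problem OS(ŷ) has at least one feasible solution, then its minimum is attained, and it is attained by some optimal solution (z, u) in which every delivery quantity u(i,v,t) is a nonnegative integer. -/

import Mathlib

open Finset

/-- Inventory levels `Î(y,u)` determined by the recursion
`Î(0,i) = I0 i` and `Î(t+1,i) = Î(t,i) + Σ_v u(i,v,t) − y(i,t)`. -/
noncomputable def inventory {N V : Type*} [Fintype V]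
    (I0 : N → ℝ) (y : N → ℕ → ℝ) (u : N → V → ℕ → ℝ) : ℕ → N → ℝ
  | 0 => I0
  | t + 1 => fun i => inventory I0 y u t i + (∑ v : V, u i v t) - y i t

/-- Feasibility of a solution `(z, u)` for the demand scenario `y` over the
periods `T = {0, …, ℓ−1}`.  The warehouse is `none : Option N` and the
retailers are `some i`; edges are ordered pairs of distinct nodes. -/
def Feasible {N V : Type*} [Fintype N] [DecidableEq N] [Fintype V]
    (ℓ : ℕ) (Q Imax M : ℝ) (I0 : N → ℝ) (y : N → ℕ → ℝ)
    (z : Option N → Option N → V → ℕ → ℝ) (u : N → V → ℕ → ℝ) : Prop :=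
  -- routing variables are binary
  (∀ i j v t, z i j v t = 0 ∨ z i j v t = 1) ∧
  -- delivery quantities are nonnegative
  (∀ i v t, 0 ≤ u i v t) ∧
  -- (i) each vehicle leaves and returns to the warehouse exactly once per period
  (∀ v t, t < ℓ →
    (∑ j ∈ univ.erase (none : Option N), z none j v t) = 1 ∧
    (∑ j ∈ univ.erase (none : Option N), z j none v t) = 1) ∧
  -- (ii) flow conservation at each retailer
  (∀ (i : N) (v : V) (t : ℕ), t < ℓ →
    (∑ j ∈ univ.erase (some i), z (some i) j v t)
      = ∑ j ∈ univ.erase (some i), z j (some i) v t) ∧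
  -- (iii) each retailer is visited at most once per period
  (∀ (i : N) (t : ℕ), t < ℓ →
    (∑ v : V, ∑ j ∈ univ.erase (some i), z (some i) j v t) ≤ 1) ∧
  -- (iv) big-M linking of deliveries and visits
  (∀ (i : N) (v : V) (t : ℕ), t < ℓ →
    u i v t ≤ M * ∑ j ∈ univ.erase (some i), z (some i) j v t) ∧
  -- (v) vehicle capacity
  (∀ (v : V) (t : ℕ), t < ℓ → (∑ i : N, u i v t) ≤ Q) ∧
  -- (vi) inventory capacity
  (∀ (i : N) (v : V) (t : ℕ), t < ℓ → u i v t ≤ Imax - inventory I0 y u t i) ∧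
  -- (vii) subtour elimination
  (∀ (v : V) (t : ℕ), t < ℓ → ∀ S : Finset N, 2 ≤ S.card →
    (∑ i ∈ S, ∑ j ∈ S.erase i, z (some i) (some j) v t) ≤ (S.card : ℝ) - 1)

/-- Cost `C(y, z, u)` of a solution under scenario `y`: transportation cost
plus holding and backorder costs. -/
noncomputable def cost {N V : Type*} [Fintype N] [DecidableEq N] [Fintype V]
    (ℓ : ℕ) (c : Option N → Option N → ℝ) (h e : ℝ) (I0 : N → ℝ)
    (y : N → ℕ → ℝ)
    (z : Option N → Option N → V → ℕ → ℝ) (u : N → V → ℕ → ℝ) : ℝ :=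
  (∑ t ∈ Finset.range ℓ, ∑ i : Option N, ∑ j ∈ univ.erase i, ∑ v : V, c i j * z i j v t)
    + ∑ t ∈ Finset.range ℓ, ∑ i : N,
        (h * max (inventory I0 y u (t + 1) i) 0
          + e * max (-(inventory I0 y u (t + 1) i)) 0)

/-- The integers inside the reals, as an additive subgroup. -/
def intSub : AddSubgroup ℝ := (Int.castAddHom ℝ).range

lemma mem_intSub {x : ℝ} : x ∈ intSub ↔ ∃ q : ℤ, x = (q : ℝ) := by
  unfold intSub
  rw [AddMonoidHom.mem_range]
  constructor
  · rintro ⟨q, hq⟩; exact ⟨q, hq.symm⟩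
  · rintro ⟨q, hq⟩; exact ⟨q, hq.symm⟩

/-- Incidence coefficient of an edge at a node. -/
noncomputable def coef {E W : Type*} [DecidableEq W] (src dst : E → W) (n : W) (e : E) : ℝ :=
  (if src e = n then 1 else 0) - (if dst e = n then 1 else 0)

/-- Net outflow at a node. -/
noncomputable def ndiv {E W : Type*} [Fintype E] [DecidableEq W] (src dst : E → W)
    (f : E → ℝ) (n : W) : ℝ := ∑ e, coef src dst n e * f e

lemma sum_coef {E W : Type*} [DecidableEq W] (src dst : E → W) (S : Finset W) (e : E)
    (h1 : src e ∈ S) (h2 : dst e ∈ S) : ∑ n ∈ S, coef src dst n e = 0 := by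
  unfold coef
  rw [Finset.sum_sub_distrib, Finset.sum_ite_eq, Finset.sum_ite_eq]
  simp [h1, h2]

lemma root_int {E W : Type*} [Fintype E] [DecidableEq W] (src dst : E → W)
    (f : E → ℝ) (r : W) (h : ∀ n, n ≠ r → ndiv src dst f n ∈ intSub) (n : W) :
    ndiv src dst f n ∈ intSub := by
  by_cases hn : n = r
  · subst hn
    set S : Finset W := insert n (univ.image src ∪ univ.image dst) with hS
    have h0 : ∑ m ∈ S, ndiv src dst f m = 0 := by
      unfold ndiv
      rw [Finset.sum_comm]
      apply Finset.sum_eq_zero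
      intro e _
      rw [← Finset.sum_mul, sum_coef, zero_mul] <;> simp [hS]
    rw [← Finset.add_sum_erase S _ (Finset.mem_insert_self _ _)] at h0
    have : ndiv src dst f n = - ∑ m ∈ S.erase n, ndiv src dst f m := by linarith
    rw [this]
    apply neg_mem
    apply sum_mem
    intro m hm
    exact h m (Finset.ne_of_mem_erase hm)
  · exact h n hn

lemma deg_two {E W : Type*} [Fintype E] [DecidableEq W] (src dst : E → W)
    (f : E → ℝ) (F : Finset E) (hF : ∀ e, e ∈ F ↔ f e ∉ intSub) (n : W)
    (hn : ndiv src dst f n ∈ intSub) (e : E) (he : e ∈ F) (hen : src e = n ∨ dst e = n) :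
    2 ≤ ∑ e ∈ F, ((if src e = n then 1 else 0) + (if dst e = n then 1 else 0) : ℕ) := by
  classical
  by_contra hlt
  push Not at hlt
  rw [← Finset.add_sum_erase F _ he] at hlt
  have hrest : ∀ e' ∈ F.erase e, coef src dst n e' = 0 := by
    have h0 : ∑ e ∈ F.erase e, ((if src e = n then 1 else 0) + (if dst e = n then 1 else 0) : ℕ)
        = 0 := by
      rcases hen with h | h <;> simp only [h, if_true] at hlt <;> omega
    rw [Finset.sum_eq_zero_iff] at h0
    intro e' he'
    have := h0 e' he'
    unfold coef
    split_ifs at this ⊢ <;> simp_all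
  have hce : coef src dst n e = 1 ∨ coef src dst n e = -1 := by
    unfold coef
    by_cases h1 : src e = n <;> by_cases h2 : dst e = n
    · simp [h1, h2] at hlt; omega
    · simp [h1, h2]
    · simp [h1, h2]
    · tauto
  apply (hF e).1 he
  unfold ndiv at hn
  rw [← Finset.add_sum_erase univ _ (Finset.mem_univ e)] at hn
  have hr : ∑ e' ∈ univ.erase e, coef src dst n e' * f e' ∈ intSub := by
    apply sum_mem
    intro e' he'
    by_cases hf : e' ∈ F
    · rw [hrest e' (Finset.mem_erase.2 ⟨Finset.ne_of_mem_erase he', hf⟩), zero_mul]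
      exact zero_mem _
    · have hi : f e' ∈ intSub := by
        by_contra hc
        exact hf ((hF e').2 hc)
      unfold coef
      split_ifs
      · simpa using zero_mem intSub
      · simpa using hi
      · simpa using hi
      · simpa using zero_mem intSub
  have hm := sub_mem hn hr
  rw [add_sub_cancel_right] at hm
  rcases hce with h | h
  · rw [h, one_mul] at hm; exact hm
  · rw [h] at hm; simpa using hm

lemma exists_circ {E W : Type*} [Fintype E] [DecidableEq W] (src dst : E → W)
    (f : E → ℝ) (hdiv : ∀ n, ndiv src dst f n ∈ intSub) (e0 : E) (he0 : f e0 ∉ intSub) :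
    ∃ w : E → ℝ, (∀ n, ndiv src dst w n = 0) ∧ (∀ e, f e ∈ intSub → w e = 0) ∧
      ∃ e, w e ≠ 0 := by
  classical
  set F : Finset E := univ.filter (fun e => f e ∉ intSub) with hFdef
  have hF : ∀ e, e ∈ F ↔ f e ∉ intSub := by intro e; simp [hFdef]
  set T : Finset W := F.image src ∪ F.image dst with hT
  have hs : ∀ e ∈ F, src e ∈ T := fun e he =>
    Finset.mem_union_left _ (Finset.mem_image_of_mem _ he)
  have hd : ∀ e ∈ F, dst e ∈ T := fun e he =>
    Finset.mem_union_right _ (Finset.mem_image_of_mem _ he)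
  have hcard : T.card ≤ F.card := by
    have h1 : ∑ n ∈ T, 2 ≤ ∑ n ∈ T, ∑ e ∈ F,
        ((if src e = n then 1 else 0) + (if dst e = n then 1 else 0) : ℕ) := by
      apply Finset.sum_le_sum
      intro n hn
      rcases Finset.mem_union.1 hn with h | h
      · obtain ⟨e, he, hen⟩ := Finset.mem_image.1 h
        exact deg_two src dst f F hF n (hdiv n) e he (Or.inl hen)
      · obtain ⟨e, he, hen⟩ := Finset.mem_image.1 h
        exact deg_two src dst f F hF n (hdiv n) e he (Or.inr hen)
    rw [Finset.sum_comm] at h1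
    have h2 : ∑ e ∈ F, ∑ n ∈ T,
        ((if src e = n then 1 else 0) + (if dst e = n then 1 else 0) : ℕ) = ∑ e ∈ F, 2 := by
      apply Finset.sum_congr rfl
      intro e he
      rw [Finset.sum_add_distrib, Finset.sum_ite_eq, Finset.sum_ite_eq]
      simp [hs e he, hd e he]
    rw [h2] at h1
    simp at h1
    omega
  let A : (F → ℝ) →ₗ[ℝ] (T → ℝ) :=
    { toFun := fun w n => ∑ e : F, coef src dst n e * w e
      map_add' := by
        intro a b; funext n; simp [mul_add, Finset.sum_add_distrib]
      map_smul' := by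
        intro a b; funext n; simp [Finset.mul_sum]
        apply Finset.sum_congr rfl; intros; ring }
  have hAsum : ∀ w, ∑ n : T, A w n = 0 := by
    intro w
    change ∑ n : T, ∑ e : F, coef src dst n e * w e = 0
    rw [Finset.sum_comm]
    apply Finset.sum_eq_zero
    intro e _
    rw [← Finset.sum_mul]
    rw [Finset.sum_coe_sort T (fun n => coef src dst n e),
      sum_coef src dst T e (hs e e.2) (hd e e.2), zero_mul]
  have hninj : ¬ Function.Injective A := by
    intro hinj
    have h1 := LinearMap.finrank_le_finrank_of_injective hinj
    simp only [Module.finrank_fintype_fun_eq_card, Fintype.card_coe] at h1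
    have hsur := (LinearMap.injective_iff_surjective_of_finrank_eq_finrank (f := A) (by
      simp only [Module.finrank_fintype_fun_eq_card, Fintype.card_coe]; omega)).1 hinj
    obtain ⟨w, hw⟩ := hsur (fun _ => 1)
    have := hAsum w
    rw [hw] at this
    simp at this
    have hm := hs e0 ((hF e0).2 he0)
    rw [this] at hm
    simp at hm
  have : ∃ w, A w = 0 ∧ w ≠ 0 := by
    by_contra hc
    push Not at hc
    exact hninj ((injective_iff_map_eq_zero A).2 hc)
  obtain ⟨w, hw0, hwne⟩ := this
  refine ⟨fun e => if h : e ∈ F then w ⟨e, h⟩ else 0, ?_, ?_, ?_⟩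
  · intro n
    unfold ndiv
    have hred : ∑ e, coef src dst n e * (if h : e ∈ F then w ⟨e, h⟩ else 0)
        = ∑ e : F, coef src dst n e * w e := by
      rw [← Finset.sum_subset (Finset.subset_univ F)]
      · rw [← Finset.sum_coe_sort F]
        apply Finset.sum_congr rfl
        intro e _
        simp
      · intro e _ he
        simp [he]
    rw [hred]
    by_cases hn : n ∈ T
    · exact congrFun hw0 ⟨n, hn⟩
    · apply Finset.sum_eq_zero
      intro e _
      have h1 : src e ≠ n := fun h => hn (h ▸ hs e e.2)
      have h2 : dst e ≠ n := fun h => hn (h ▸ hd e e.2)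
      simp [coef, h1, h2]
  · intro e he
    have : e ∉ F := fun h => (hF e).1 h he
    simp [this]
  · obtain ⟨e, he⟩ := Function.ne_iff.1 hwne
    refine ⟨e, ?_⟩
    simpa using he

lemma floor_lt_of_frac {x : ℝ} (h : x ∉ intSub) : (⌊x⌋ : ℝ) < x := by
  rcases lt_or_eq_of_le (Int.floor_le x) with h' | h'
  · exact h'
  · exact absurd (mem_intSub.2 ⟨_, h'.symm⟩) h

lemma lt_ceil_of_frac {x : ℝ} (h : x ∉ intSub) : x < (⌈x⌉ : ℝ) := by
  rcases lt_or_eq_of_le (Int.le_ceil x) with h' | h'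
  · exact h'
  · exact absurd (mem_intSub.2 ⟨_, h'⟩) h

lemma round_step {E W : Type*} [Fintype E] [DecidableEq W] (src dst : E → W)
    (wt f : E → ℝ) (hdiv : ∀ n, ndiv src dst f n ∈ intSub) (e0 : E) (he0 : f e0 ∉ intSub) :
    ∃ g : E → ℝ, (∀ n, ndiv src dst g n = ndiv src dst f n) ∧
      (∀ e, (⌊f e⌋ : ℝ) ≤ g e ∧ g e ≤ ⌈f e⌉) ∧ (∑ e, wt e * g e ≤ ∑ e, wt e * f e) ∧
      (∀ e, f e ∈ intSub → g e ∈ intSub) ∧ ∃ e, f e ∉ intSub ∧ g e ∈ intSub := by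
  classical
  have key : ∃ w : E → ℝ, (∀ n, ndiv src dst w n = 0) ∧ (∀ e, f e ∈ intSub → w e = 0) ∧
      (∃ e, w e ≠ 0) ∧ ∑ e, wt e * w e ≤ 0 := by
    obtain ⟨w, h1, h2, e, h3⟩ := exists_circ src dst f hdiv e0 he0
    rcases le_total (∑ e, wt e * w e) 0 with h | h
    · exact ⟨w, h1, h2, ⟨e, h3⟩, h⟩
    · refine ⟨fun e => - w e, ?_, ?_, ⟨e, by simpa using h3⟩, by simpa using h⟩
      · intro n
        have := h1 n
        unfold ndiv at this ⊢
        simp [this]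
      · intro e he; simp [h2 e he]
  obtain ⟨w, h1, h2, ⟨e1, h3⟩, h4⟩ := key
  let s : E → ℝ := fun e => if 0 < w e then (⌈f e⌉ - f e) / w e else (f e - ⌊f e⌋) / (- w e)
  obtain ⟨em, hem, hmin⟩ := Finset.exists_min_image (univ.filter (fun e => w e ≠ 0)) s
    ⟨e1, by simpa using h3⟩
  have hwm : w em ≠ 0 := by simpa using hem
  have hfm : f em ∉ intSub := fun h => hwm (h2 em h)
  have hs0 : 0 ≤ s em := by
    simp only [s]
    split_ifs with h
    · exact div_nonneg (by linarith [Int.le_ceil (f em)]) h.le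
    · exact div_nonneg (by linarith [Int.floor_le (f em)]) (by linarith)
  refine ⟨fun e => f e + s em * w e, ?_, ?_, ?_, ?_, em, hfm, ?_⟩
  · intro n
    have := h1 n
    unfold ndiv at this ⊢
    have h5 : ∀ e, coef src dst n e * (f e + s em * w e)
      = coef src dst n e * f e + s em * (coef src dst n e * w e) := by intro e; ring
    simp only [h5]
    rw [Finset.sum_add_distrib, ← Finset.mul_sum, this]; ring
  · intro e
    have hfl := Int.floor_le (f e)
    have hce := Int.le_ceil (f e)
    rcases lt_trichotomy (w e) 0 with h | h | h
    · have hm := hmin e (by simpa using h.ne)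
      have hse : s e = (f e - ⌊f e⌋) / (- w e) := by simp only [s]; rw [if_neg (by linarith)]
      rw [hse, le_div_iff₀ (by linarith)] at hm
      have := mul_nonneg hs0 (neg_nonneg.2 h.le)
      constructor <;> linarith
    · simp [h, hfl, hce]
    · have hm := hmin e (by simpa using h.ne')
      have hse : s e = (⌈f e⌉ - f e) / w e := by simp only [s]; rw [if_pos h]
      rw [hse, le_div_iff₀ h] at hm
      have := mul_nonneg hs0 h.le
      constructor <;> linarith
  · have h5 : ∀ e, wt e * (f e + s em * w e) = wt e * f e + s em * (wt e * w e) := by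
      intro e; ring
    simp only [h5]
    rw [Finset.sum_add_distrib, ← Finset.mul_sum]
    have := mul_nonneg hs0 (neg_nonneg.2 h4)
    linarith
  · intro e he
    simpa [h2 e he] using he
  · rw [mem_intSub]
    by_cases h : 0 < w em
    · refine ⟨⌈f em⌉, ?_⟩
      have hse : s em = (⌈f em⌉ - f em) / w em := by simp only [s]; rw [if_pos h]
      simp only [hse]
      field_simp
      ring
    · refine ⟨⌊f em⌋, ?_⟩
      have hse : s em = (f em - ⌊f em⌋) / (- w em) := by simp only [s]; rw [if_neg h]
      simp only [hse]
      field_simp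
      ring

lemma round_flow {E W : Type*} [Fintype E] [DecidableEq W] (src dst : E → W)
    (wt : E → ℝ) (k : ℕ) : ∀ (f : E → ℝ), (∀ n, ndiv src dst f n ∈ intSub) →
    {e | f e ∉ intSub}.ncard ≤ k →
    ∃ g : E → ℝ, (∀ n, ndiv src dst g n = ndiv src dst f n) ∧
      (∀ e, (⌊f e⌋ : ℝ) ≤ g e ∧ g e ≤ ⌈f e⌉) ∧ (∑ e, wt e * g e ≤ ∑ e, wt e * f e) ∧
      (∀ e, g e ∈ intSub) := by
  induction k with
  | zero =>
    intro f hdiv hk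
    refine ⟨f, fun _ => rfl, fun e => ⟨Int.floor_le _, Int.le_ceil _⟩, le_rfl, ?_⟩
    intro e
    by_contra he
    have h0 := (Set.ncard_eq_zero (Set.toFinite _)).1 (Nat.le_zero.1 hk)
    have : e ∈ ({e | f e ∉ intSub} : Set E) := he
    rw [h0] at this
    exact this
  | succ k ih =>
    intro f hdiv hk
    by_cases hall : ∀ e, f e ∈ intSub
    · exact ⟨f, fun _ => rfl, fun e => ⟨Int.floor_le _, Int.le_ceil _⟩, le_rfl, hall⟩
    · push Not at hall
      obtain ⟨e0, he0⟩ := hall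
      obtain ⟨f', a1, a2, a3, a4, e1, a5, a6⟩ := round_step src dst wt f hdiv e0 he0
      have hlt : {e | f' e ∉ intSub}.ncard < {e | f e ∉ intSub}.ncard := by
        apply Set.ncard_lt_ncard _ (Set.toFinite _)
        refine ⟨fun e he h => he (a4 e h), fun h => ?_⟩
        exact h (show e1 ∈ {e | f e ∉ intSub} from a5) a6
      obtain ⟨g, b1, b2, b3, b4⟩ := ih f' (fun n => by rw [a1 n]; exact hdiv n) (by omega)
      refine ⟨g, fun n => (b1 n).trans (a1 n), fun e => ⟨?_, ?_⟩, b3.trans a3, b4⟩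
      · refine le_trans ?_ (b2 e).1
        exact_mod_cast Int.le_floor.2 (a2 e).1
      · refine le_trans (b2 e).2 ?_
        exact_mod_cast Int.ceil_le.2 (a2 e).2

/-- Source of each edge in the flow network. -/
def esrc {N V : Type*} (ℓ : ℕ) :
    (N × V × Fin ℓ) ⊕ (N × Fin ℓ) ⊕ (V × Fin ℓ) → Option ((N × Fin ℓ) ⊕ (V × Fin ℓ))
  | Sum.inl (_, v, t) => some (Sum.inr (v, t))
  | Sum.inr (Sum.inl (i, t)) => some (Sum.inl (i, t))
  | Sum.inr (Sum.inr _) => none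

/-- Target of each edge in the flow network. -/
def edst {N V : Type*} (ℓ : ℕ) :
    (N × V × Fin ℓ) ⊕ (N × Fin ℓ) ⊕ (V × Fin ℓ) → Option ((N × Fin ℓ) ⊕ (V × Fin ℓ))
  | Sum.inl (i, _, t) => some (Sum.inl (i, t))
  | Sum.inr (Sum.inl (i, t)) => if h : (t : ℕ) + 1 < ℓ then some (Sum.inl (i, ⟨t + 1, h⟩)) else none
  | Sum.inr (Sum.inr (v, t)) => some (Sum.inr (v, t))

lemma sum_pair_ite {A B : Type*} [Fintype A] [Fintype B] [DecidableEq A] [DecidableEq B]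
    (f : A → B → ℝ) (a : A) (b : B) :
    ∑ x, ∑ y, (if x = a ∧ y = b then f x y else 0) = f a b := by
  simp only [ite_and]
  simp

lemma ndiv_inr {N V : Type*} [Fintype N] [DecidableEq N] [Fintype V] [DecidableEq V] (ℓ : ℕ)
    (f : (N × V × Fin ℓ) ⊕ (N × Fin ℓ) ⊕ (V × Fin ℓ) → ℝ) (v : V) (t : Fin ℓ) :
    ndiv (esrc ℓ) (edst ℓ) f (some (Sum.inr (v, t)))
      = ∑ i, f (Sum.inl (i, v, t)) - f (Sum.inr (Sum.inr (v, t))) := by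
  unfold ndiv
  have h0 : ∀ (i : N) (t' : Fin ℓ),
      edst ℓ (Sum.inr (Sum.inl (i, t'))) ≠ some (Sum.inr (v, t)) := by
    intro i t'; simp only [edst]; split_ifs <;> simp
  simp only [Fintype.sum_sum_type, Fintype.sum_prod_type, coef, h0]
  simp only [esrc, edst, Option.some.injEq, Sum.inr.injEq, Prod.mk.injEq, reduceCtorEq, if_false,
    sub_zero, zero_sub, sub_mul, ite_mul, one_mul, zero_mul, sum_pair_ite, Finset.sum_neg_distrib,
    neg_mul, sub_self, Finset.sum_const_zero, zero_add]
  ring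

lemma ndiv_inl {N V : Type*} [Fintype N] [DecidableEq N] [Fintype V] [DecidableEq V] (ℓ : ℕ)
    (f : (N × V × Fin ℓ) ⊕ (N × Fin ℓ) ⊕ (V × Fin ℓ) → ℝ) (i : N) (t : Fin ℓ) :
    ndiv (esrc ℓ) (edst ℓ) f (some (Sum.inl (i, t)))
      = f (Sum.inr (Sum.inl (i, t))) - ∑ v, f (Sum.inl (i, v, t))
        - ∑ s : Fin ℓ, (if (s : ℕ) + 1 = t then f (Sum.inr (Sum.inl (i, s))) else 0) := by
  unfold ndiv
  have h0 : ∀ (i' : N) (t' : Fin ℓ),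
      (edst ℓ (Sum.inr (Sum.inl (i', t'))) = some (Sum.inl (i, t) : (N × Fin ℓ) ⊕ (V × Fin ℓ)))
        ↔ (i' = i ∧ (t' : ℕ) + 1 = t) := by
    intro i' t'; simp only [edst]
    have := t.2
    split_ifs with h
    · simp [Fin.ext_iff]
    · simp; omega
  simp only [Fintype.sum_sum_type, Fintype.sum_prod_type, coef, h0]
  simp only [esrc, edst, Option.some.injEq, Sum.inl.injEq, Prod.mk.injEq, reduceCtorEq, if_false,
    sub_zero, zero_sub, sub_mul, ite_mul, one_mul, zero_mul, sum_pair_ite, Finset.sum_neg_distrib,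
    neg_mul, sub_self, Finset.sum_const_zero, zero_add, Finset.sum_sub_distrib]
  have e1 : ∑ x : N, ∑ y : V, ∑ s : Fin ℓ, (if x = i ∧ s = t then f (Sum.inl (x, y, s)) else 0)
      = ∑ v, f (Sum.inl (i, v, t)) := by
    rw [Finset.sum_comm]
    simp only [sum_pair_ite]
  have e2 : ∑ x : N, ∑ s : Fin ℓ,
      (if x = i ∧ (s : ℕ) + 1 = t then f (Sum.inr (Sum.inl (x, s))) else 0)
      = ∑ s : Fin ℓ, (if (s : ℕ) + 1 = t then f (Sum.inr (Sum.inl (i, s))) else 0) := by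
    rw [Finset.sum_comm]
    apply Finset.sum_congr rfl
    intro s _
    simp only [ite_and]
    simp
  rw [e1, e2]
  ring

lemma pred_sum (ℓ : ℕ) (F : Fin ℓ → ℝ) (s : ℕ) (hs : s + 1 < ℓ) :
    ∑ k : Fin ℓ, (if (k : ℕ) + 1 = s + 1 then F k else 0) = F ⟨s, by omega⟩ := by
  rw [Finset.sum_eq_single ⟨s, by omega⟩]
  · simp
  · intro b _ hb
    rw [if_neg]
    intro h
    apply hb
    ext
    simpa using h
  · simp

lemma phi_lin (h e a b : ℝ) (hb : (⌊a⌋ : ℝ) ≤ b ∧ b ≤ ⌈a⌉) :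
    h * max b 0 + e * max (-b) 0 = (if 0 ≤ a then h else -e) * b := by
  split_ifs with ha
  · have h0 : (0 : ℝ) ≤ ⌊a⌋ := by exact_mod_cast Int.floor_nonneg.2 ha
    have hb0 : 0 ≤ b := h0.trans hb.1
    rw [max_eq_left hb0, max_eq_right (by linarith)]; ring
  · have h0 : (⌈a⌉ : ℝ) ≤ 0 := by
      have : ⌈a⌉ ≤ 0 := Int.ceil_le.2 (by push_cast; linarith)
      exact_mod_cast this
    have hb0 : b ≤ 0 := hb.2.trans h0
    rw [max_eq_right hb0, max_eq_left (by linarith)]; ring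

lemma le_of_ceil {a b c : ℝ} (hb : b ≤ ⌈a⌉) (hac : a ≤ c) (hc : c ∈ intSub) : b ≤ c := by
  obtain ⟨q, rfl⟩ := mem_intSub.1 hc
  refine hb.trans ?_
  exact_mod_cast Int.ceil_le.2 hac

lemma inventory_succ {N V : Type*} [Fintype V] (I0 : N → ℝ) (y : N → ℕ → ℝ)
    (u : N → V → ℕ → ℝ) (t : ℕ) (i : N) : inventory I0 y u (t + 1) i
      = inventory I0 y u t i + (∑ v : V, u i v t) - y i t := rfl

lemma inventory_congr {N V : Type*} [Fintype V] (ℓ : ℕ) (I0 : N → ℝ) (y : N → ℕ → ℝ)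
    (u u' : N → V → ℕ → ℝ) (huu : ∀ i v t, t < ℓ → u i v t = u' i v t) (t : ℕ) (ht : t ≤ ℓ)
    (i : N) : inventory I0 y u t i = inventory I0 y u' t i := by
  induction t with
  | zero => rfl
  | succ t ih =>
    simp only [inventory]
    rw [ih (by omega), Finset.sum_congr rfl (fun v _ => huu i v t (by omega))]

lemma cost_congr {N V : Type*} [Fintype N] [DecidableEq N] [Fintype V]
    (ℓ : ℕ) (c : Option N → Option N → ℝ) (h e : ℝ) (I0 : N → ℝ) (y : N → ℕ → ℝ)
    (z z' : Option N → Option N → V → ℕ → ℝ) (u u' : N → V → ℕ → ℝ)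
    (hzz : ∀ i j v t, t < ℓ → z i j v t = z' i j v t)
    (huu : ∀ i v t, t < ℓ → u i v t = u' i v t) :
    cost ℓ c h e I0 y z u = cost ℓ c h e I0 y z' u' := by
  unfold cost
  congr 1
  · refine Finset.sum_congr rfl fun t ht => Finset.sum_congr rfl fun i _ =>
      Finset.sum_congr rfl fun j _ => Finset.sum_congr rfl fun v _ => ?_
    rw [hzz i j v t (Finset.mem_range.1 ht)]
  · refine Finset.sum_congr rfl fun t ht => Finset.sum_congr rfl fun i _ => ?_
    rw [inventory_congr ℓ I0 y u u' huu (t + 1) (Finset.mem_range.1 ht) i]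

lemma round_solution {N V : Type*} [Fintype N] [DecidableEq N] [Fintype V]
    (ℓ : ℕ) (c : Option N → Option N → ℝ)
    (Q Imax h e M : ℝ)
    (hQint : Q ∈ intSub) (hImaxint : Imax ∈ intSub) (hMint : ∃ q : ℤ, M = (q : ℝ))
    (I0 : N → ℝ) (hI0int : ∀ i, I0 i ∈ intSub)
    (y : N → ℕ → ℝ) (hyint : ∀ i t, t < ℓ → y i t ∈ intSub)
    (z : Option N → Option N → V → ℕ → ℝ) (u : N → V → ℕ → ℝ)
    (hf : Feasible ℓ Q Imax M I0 y z u) :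
    ∃ u' : N → V → ℕ → ℝ, Feasible ℓ Q Imax M I0 y z u' ∧
      cost ℓ c h e I0 y z u' ≤ cost ℓ c h e I0 y z u ∧
      (∀ (i : N) (v : V) (t : ℕ), t < ℓ → ∃ q : ℕ, u' i v t = (q : ℝ)) := by
  classical
  obtain ⟨hz, hu, h1, h2, h3, h4, h5, h6, h7⟩ := hf
  -- the flow
  let f : (N × V × Fin ℓ) ⊕ (N × Fin ℓ) ⊕ (V × Fin ℓ) → ℝ := fun x => match x with
    | Sum.inl (i, v, t) => u i v t
    | Sum.inr (Sum.inl (i, t)) => inventory I0 y u (t + 1) i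
    | Sum.inr (Sum.inr (v, t)) => ∑ i, u i v t
  let wt : (N × V × Fin ℓ) ⊕ (N × Fin ℓ) ⊕ (V × Fin ℓ) → ℝ := fun x => match x with
    | Sum.inl _ => 0
    | Sum.inr (Sum.inl (i, t)) => if 0 ≤ inventory I0 y u (t + 1) i then h else -e
    | Sum.inr (Sum.inr _) => 0
  have d0 : ∀ (i : N) (h0 : 0 < ℓ), ndiv (esrc ℓ) (edst ℓ) f (some (Sum.inl (i, ⟨0, h0⟩)))
      = I0 i - y i 0 := by
    intro i h0
    rw [ndiv_inl]
    simp [f, inventory]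
    ring
  have ds : ∀ (i : N) (s : ℕ) (h0 : s + 1 < ℓ),
      ndiv (esrc ℓ) (edst ℓ) f (some (Sum.inl (i, ⟨s + 1, h0⟩))) = - y i (s + 1) := by
    intro i s h0
    rw [ndiv_inl, pred_sum ℓ (fun k => f (Sum.inr (Sum.inl (i, k)))) s h0]
    simp only [f, inventory]
    ring
  have dr : ∀ (v : V) (t : Fin ℓ),
      ndiv (esrc ℓ) (edst ℓ) f (some (Sum.inr (v, t))) = 0 := by
    intro v t
    rw [ndiv_inr]
    simp [f]
  have hdiv : ∀ n, ndiv (esrc ℓ) (edst ℓ) f n ∈ intSub := by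
    apply root_int _ _ _ none
    rintro (_ | ⟨i, ⟨_ | s, ht⟩⟩ | ⟨v, t⟩) hn
    · exact absurd rfl hn
    · rw [d0]; exact sub_mem (hI0int i) (hyint i 0 ht)
    · rw [ds]; exact neg_mem (hyint i _ ht)
    · rw [dr]; exact zero_mem _
  obtain ⟨g, g1, g2, g3, g4⟩ := round_flow (esrc ℓ) (edst ℓ) wt _ f hdiv le_rfl
  let u' : N → V → ℕ → ℝ := fun i v t => if ht : t < ℓ then g (Sum.inl (i, v, ⟨t, ht⟩)) else 0
  have hu' : ∀ i v t (ht : t < ℓ), u' i v t = g (Sum.inl (i, v, ⟨t, ht⟩)) := by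
    intro i v t ht; simp [u', ht]
  have hub : ∀ i v t, t < ℓ → (⌊u i v t⌋ : ℝ) ≤ u' i v t ∧ u' i v t ≤ ⌈u i v t⌉ := by
    intro i v t ht
    rw [hu' i v t ht]
    exact g2 (Sum.inl (i, v, ⟨t, ht⟩))
  have hu0 : ∀ i v t, 0 ≤ u' i v t := by
    intro i v t
    by_cases ht : t < ℓ
    · refine le_trans ?_ (hub i v t ht).1
      exact_mod_cast Int.floor_nonneg.2 (hu i v t)
    · simp [u', ht]
  have hinv : ∀ (i : N) (t : ℕ) (ht : t < ℓ),
      inventory I0 y u' (t + 1) i = g (Sum.inr (Sum.inl (i, ⟨t, ht⟩))) := by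
    intro i t
    induction t with
    | zero =>
      intro ht
      have := (g1 (some (Sum.inl (i, ⟨0, ht⟩)))).trans (d0 i ht)
      rw [ndiv_inl] at this
      simp at this
      simp only [inventory, hu' i _ 0 ht]
      linarith
    | succ s ih =>
      intro ht
      have := (g1 (some (Sum.inl (i, ⟨s + 1, ht⟩)))).trans (ds i s ht)
      rw [ndiv_inl, pred_sum ℓ (fun k => g (Sum.inr (Sum.inl (i, k)))) s ht] at this
      have ih' := ih (by omega)
      rw [inventory_succ, ih']
      simp only [hu' i _ (s + 1) ht]
      linarith
  have hinvb : ∀ (i : N) (t : ℕ), t < ℓ →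
      (⌊inventory I0 y u (t + 1) i⌋ : ℝ) ≤ inventory I0 y u' (t + 1) i ∧
        inventory I0 y u' (t + 1) i ≤ ⌈inventory I0 y u (t + 1) i⌉ := by
    intro i t ht
    rw [hinv i t ht]
    exact g2 (Sum.inr (Sum.inl (i, ⟨t, ht⟩)))
  have hzero : ∀ i v t, t < ℓ → u i v t = 0 → u' i v t = 0 := by
    intro i v t ht h0
    have := hub i v t ht
    rw [h0] at this
    simp at this
    linarith [this.1, this.2]
  have hzsum : ∀ i v t, ∑ j ∈ univ.erase (some i), z (some i) j v t ∈ intSub := by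
    intro i v t
    apply sum_mem
    intro j _
    rw [mem_intSub]
    rcases hz (some i) j v t with h | h
    · exact ⟨0, by simp [h]⟩
    · exact ⟨1, by simp [h]⟩
  have hz0 : ∀ i v t, 0 ≤ ∑ j ∈ univ.erase (some i), z (some i) j v t := by
    intro i v t
    apply Finset.sum_nonneg
    intro j _
    rcases hz (some i) j v t with h | h <;> simp [h]
  refine ⟨u', ⟨hz, hu0, h1, h2, h3, ?_, ?_, ?_, h7⟩, ?_, ?_⟩
  · intro i v t ht
    refine le_of_ceil (hub i v t ht).2 (h4 i v t ht) ?_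
    obtain ⟨q, hq⟩ := hMint
    obtain ⟨r, hr⟩ := mem_intSub.1 (hzsum i v t)
    exact mem_intSub.2 ⟨q * r, by rw [hq, hr]; push_cast; ring⟩
  · intro v t ht
    have h := (g1 (some (Sum.inr (v, ⟨t, ht⟩)))).trans (dr v ⟨t, ht⟩)
    rw [ndiv_inr] at h
    have hs : ∑ i, u' i v t = g (Sum.inr (Sum.inr (v, ⟨t, ht⟩))) := by
      simp only [hu' _ v t ht]
      linarith
    rw [hs]
    exact le_of_ceil (g2 (Sum.inr (Sum.inr (v, ⟨t, ht⟩)))).2 (h5 v t ht) hQint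
  · intro i v t ht
    have h6' := h6 i v t ht
    by_cases hv : ∑ j ∈ univ.erase (some i), z (some i) j v t = 0
    · have hu00 : u i v t = 0 := by
        have := h4 i v t ht
        rw [hv, mul_zero] at this
        exact le_antisymm this (hu i v t)
      rw [hzero i v t ht hu00]
      rw [hu00] at h6'
      cases t with
      | zero => exact h6'
      | succ s =>
        have := le_of_ceil (hinvb i s (by omega)).2
          (show inventory I0 y u (s + 1) i ≤ Imax by linarith) hImaxint
        linarith
    · have hv1 : 1 ≤ ∑ j ∈ univ.erase (some i), z (some i) j v t := by
        have hpos := lt_of_le_of_ne (hz0 i v t) (Ne.symm hv)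
        obtain ⟨r, hr⟩ := mem_intSub.1 (hzsum i v t)
        rw [hr] at hpos ⊢
        have : 0 < r := by exact_mod_cast hpos
        exact_mod_cast this
      have hoth : ∀ v', v' ≠ v → u i v' t = 0 := by
        intro v' hne
        have hs := h3 i t ht
        rw [← Finset.add_sum_erase univ _ (Finset.mem_univ v)] at hs
        have hle := Finset.single_le_sum (s := univ.erase v)
          (f := fun v => ∑ j ∈ univ.erase (some i), z (some i) j v t)
          (fun w _ => hz0 i w t) (Finset.mem_erase.2 ⟨hne, Finset.mem_univ v'⟩)
        have hz00 : ∑ j ∈ univ.erase (some i), z (some i) j v' t = 0 :=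
          le_antisymm (by linarith) (hz0 i v' t)
        have := h4 i v' t ht
        rw [hz00, mul_zero] at this
        exact le_antisymm this (hu i v' t)
      have s1 : ∑ w, u i w t = u i v t :=
        Finset.sum_eq_single v (fun b _ hb => hoth b hb) (by simp)
      have s2 : ∑ w, u' i w t = u' i v t :=
        Finset.sum_eq_single v (fun b _ hb => hzero i b t ht (hoth b hb)) (by simp)
      have i1 : inventory I0 y u (t + 1) i = inventory I0 y u t i + u i v t - y i t := by
        rw [inventory_succ, s1]
      have i2 : inventory I0 y u' (t + 1) i = inventory I0 y u' t i + u' i v t - y i t := by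
        rw [inventory_succ, s2]
      have := le_of_ceil (hinvb i t ht).2
          (show inventory I0 y u (t + 1) i ≤ Imax - y i t by linarith)
          (sub_mem hImaxint (hyint i t ht))
      linarith
  · unfold cost
    have conv : ∀ (w : N → V → ℕ → ℝ) (k : (N × V × Fin ℓ) ⊕ (N × Fin ℓ) ⊕ (V × Fin ℓ) → ℝ),
        (∀ i t (ht : t < ℓ), inventory I0 y w (t + 1) i = k (Sum.inr (Sum.inl (i, ⟨t, ht⟩)))) →
        (∀ i t, t < ℓ → (⌊inventory I0 y u (t + 1) i⌋ : ℝ) ≤ inventory I0 y w (t + 1) i ∧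
        inventory I0 y w (t + 1) i ≤ ⌈inventory I0 y u (t + 1) i⌉) →
        ∑ t ∈ Finset.range ℓ, ∑ i : N,
        (h * max (inventory I0 y w (t + 1) i) 0
          + e * max (-(inventory I0 y w (t + 1) i)) 0) = ∑ x, wt x * k x := by
      intro w k hk hb
      simp only [Fintype.sum_sum_type, Fintype.sum_prod_type, wt, zero_mul,
        Finset.sum_const_zero, zero_add, add_zero]
      rw [Finset.sum_range, Finset.sum_comm]
      refine Finset.sum_congr rfl fun i _ => Finset.sum_congr rfl fun t _ => ?_
      rw [phi_lin h e _ _ (hb i t t.2), hk i t t.2]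
    rw [conv u' g hinv hinvb, conv u f (fun _ _ _ => rfl)
      (fun _ _ _ => ⟨Int.floor_le _, Int.le_ceil _⟩)]
    linarith
  · intro i v t ht
    have hi : u' i v t ∈ intSub := by rw [hu' i v t ht]; exact g4 _
    obtain ⟨q, hq⟩ := mem_intSub.1 hi
    have h0 := hu0 i v t
    rw [hq] at h0
    have hq0 : 0 ≤ q := by exact_mod_cast h0
    refine ⟨q.toNat, ?_⟩
    rw [hq]
    exact_mod_cast (Int.toNat_of_nonneg hq0).symm

lemma costs_finite {N V : Type*} [Fintype N] [DecidableEq N] [Fintype V]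
    (ℓ : ℕ) (c : Option N → Option N → ℝ) (Q Imax h e M : ℝ)
    (I0 : N → ℝ) (y : N → ℕ → ℝ) :
    {r : ℝ | ∃ (z : Option N → Option N → V → ℕ → ℝ) (u : N → V → ℕ → ℝ),
      Feasible ℓ Q Imax M I0 y z u ∧
      (∀ (i : N) (v : V) (t : ℕ), t < ℓ → ∃ q : ℕ, u i v t = (q : ℝ)) ∧
      cost ℓ c h e I0 y z u = r}.Finite := by
  classical
  let Z : Set (Option N × Option N × V × Fin ℓ → ℝ) := Set.pi Set.univ (fun _ => {0, 1})
  let U : Set (N × V × Fin ℓ → ℝ) :=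
    Set.pi Set.univ (fun _ => (fun n : ℕ => (n : ℝ)) '' Set.Iic ⌊Q⌋₊)
  have hZ : Z.Finite := Set.Finite.pi' (fun _ => Set.toFinite ({0, 1} : Set ℝ)) |>.subset (by
    intro x hx i; exact hx i trivial)
  have hU : U.Finite := Set.Finite.pi' (fun _ => (Set.finite_Iic ⌊Q⌋₊).image _) |>.subset (by
    intro x hx i; exact hx i trivial)
  let ez : (Option N × Option N × V × Fin ℓ → ℝ) → Option N → Option N → V → ℕ → ℝ :=
    fun a i j v t => if ht : t < ℓ then a (i, j, v, ⟨t, ht⟩) else 0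
  let eu : (N × V × Fin ℓ → ℝ) → N → V → ℕ → ℝ :=
    fun a i v t => if ht : t < ℓ then a (i, v, ⟨t, ht⟩) else 0
  refine ((hZ.prod hU).image (fun p => cost ℓ c h e I0 y (ez p.1) (eu p.2))).subset ?_
  rintro r ⟨z, u, hf, hint, rfl⟩
  refine ⟨(fun x => z x.1 x.2.1 x.2.2.1 x.2.2.2, fun x => u x.1 x.2.1 x.2.2), ⟨?_, ?_⟩, ?_⟩
  · rintro ⟨i, j, v, t⟩ _
    simpa using hf.1 i j v t
  · rintro ⟨i, v, t⟩ _
    obtain ⟨q, hq⟩ := hint i v t t.2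
    refine ⟨q, ?_, hq.symm⟩
    have h5 := hf.2.2.2.2.2.2.1 v t t.2
    have := Finset.single_le_sum (f := fun i => u i v t) (fun i _ => hf.2.1 i v t)
      (Finset.mem_univ i)
    apply Nat.le_floor
    rw [← hq]
    exact this.trans h5
  · apply cost_congr
    · intro i j v t ht; simp [ez, ht]
    · intro i v t ht; simp [eu, ht]

/-- **Integrality of optimal delivery quantities under integer data.**
If the demands are natural numbers, the initial inventories are integers, and
`Q, Imax, M` are integers with `Q ≥ 0` and `M ≥ 0`, then whenever the
single-scenario problem `OS(y)` has a feasible solution, its minimum is attained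
by an optimal solution `(z, u)` whose delivery quantities are all nonnegative
integers. -/
theorem integrality_of_optimal_deliveries
    {N V : Type*} [Fintype N] [DecidableEq N] [Fintype V] [Nonempty N] [Nonempty V]
    (ℓ : ℕ) (hℓ : 1 ≤ ℓ)
    (c : Option N → Option N → ℝ) (hc : ∀ i j, i ≠ j → 0 ≤ c i j)
    (Q Imax h e M : ℝ) (hh : 0 ≤ h) (he : 0 ≤ e) (hQ : 0 ≤ Q) (hM : 0 ≤ M)
    (hQint : ∃ q : ℤ, Q = (q : ℝ)) (hImaxint : ∃ q : ℤ, Imax = (q : ℝ))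
    (hMint : ∃ q : ℤ, M = (q : ℝ))
    (I0 : N → ℝ) (hI0int : ∀ i, ∃ q : ℤ, I0 i = (q : ℝ))
    (y : N → ℕ → ℝ) (hyint : ∀ i t, t < ℓ → ∃ q : ℕ, y i t = (q : ℝ))
    (hfeas : ∃ (z : Option N → Option N → V → ℕ → ℝ) (u : N → V → ℕ → ℝ),
      Feasible ℓ Q Imax M I0 y z u) :
    ∃ (z : Option N → Option N → V → ℕ → ℝ) (u : N → V → ℕ → ℝ),
      Feasible ℓ Q Imax M I0 y z u ∧
        (∀ (z' : Option N → Option N → V → ℕ → ℝ) (u' : N → V → ℕ → ℝ),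
          Feasible ℓ Q Imax M I0 y z' u' →
            cost ℓ c h e I0 y z u ≤ cost ℓ c h e I0 y z' u') ∧
        (∀ (i : N) (v : V) (t : ℕ), t < ℓ → ∃ q : ℕ, u i v t = (q : ℝ)) := by
  have hQ' := mem_intSub.2 hQint
  have hI' := mem_intSub.2 hImaxint
  have hI0' : ∀ i, I0 i ∈ intSub := fun i => mem_intSub.2 (hI0int i)
  have hy' : ∀ i t, t < ℓ → y i t ∈ intSub := by
    intro i t ht
    obtain ⟨q, hq⟩ := hyint i t ht
    exact mem_intSub.2 ⟨q, by simpa using hq⟩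
  obtain ⟨z0, u0, h0⟩ := hfeas
  obtain ⟨u1, a1, -, a3⟩ :=
    round_solution ℓ c Q Imax h e M hQ' hI' hMint I0 hI0' y hy' z0 u0 h0
  obtain ⟨r, ⟨z, u, b1, b2, b3⟩, hmin⟩ := Set.exists_min_image _ id
    (costs_finite (N := N) (V := V) ℓ c Q Imax h e M I0 y) ⟨_, z0, u1, a1, a3, rfl⟩
  refine ⟨z, u, b1, ?_, b2⟩
  intro z' u' hf
  obtain ⟨u2, c1, c2, c3⟩ :=
    round_solution ℓ c Q Imax h e M hQ' hI' hMint I0 hI0' y hy' z' u' hf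
  have := hmin _ ⟨z', u2, c1, c3, rfl⟩
  simp only [id] at this
  rw [b3]
  exact this.trans c2
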